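/- Let x : U → ℝ³ be a wavefront, Ω a tmb of x, and p ∈ Σ(x) with rank(Dx(p)) = 1. Then x is parallelly smoothable at p if and only if λ_Ω does not change sign on some open neighborhood of p. -/

import Mathlib

/- Common framework for frontals and tangent moving bases, following
   "Curvatures on fronts" conventions. -/

noncomputable section

open Matrix Topology Filter

/-- Points of the plane ℝ². -/
abbrev Pt : Type := Fin 2 → ℝ

/-- Jacobian matrix of a map `f : ℝ² → ℝ^m` at a point. -/
def jac {m : ℕ} (f : Pt → (Fin m → ℝ)) (p : Pt) : Matrix (Fin m) (Fin 2) ℝ :=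
  Matrix.of fun i j => fderiv ℝ f p (Pi.single j 1) i

/-- Euclidean norm of a vector in ℝ³. -/
def enorm3 (v : Fin 3 → ℝ) : ℝ := Real.sqrt (v ⬝ᵥ v)

/-- The unit normal vector field induced by a tangent moving base `Ω`,
    `n := (w₁ × w₂)/‖w₁ × w₂‖` where `w₁, w₂` are the columns of `Ω`. -/
def normalOf (Ω : Pt → Matrix (Fin 3) (Fin 2) ℝ) (p : Pt) : Fin 3 → ℝ :=
  (enorm3 (crossProduct (fun i => Ω p i 0) (fun i => Ω p i 1)))⁻¹ •
    crossProduct (fun i => Ω p i 0) (fun i => Ω p i 1)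

/-- First fundamental form matrix of a map `y`. -/
def IOf (y : Pt → Fin 3 → ℝ) (p : Pt) : Matrix (Fin 2) (Fin 2) ℝ :=
  (jac y p)ᵀ * jac y p

/-- Second fundamental form matrix of a map `y` with respect to a unit normal `ν`. -/
def IIOf (y ν : Pt → Fin 3 → ℝ) (p : Pt) : Matrix (Fin 2) (Fin 2) ℝ :=
  -((jac y p)ᵀ * jac ν p)

/-- Weingarten matrix `α := −IIᵀ I⁻¹` of a map `y` with unit normal `ν`. -/
def weinOf (y ν : Pt → Fin 3 → ℝ) (p : Pt) : Matrix (Fin 2) (Fin 2) ℝ :=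
  -((IIOf y ν p)ᵀ * (IOf y p)⁻¹)

/-- Gaussian curvature of an immersion `y` with unit normal `ν`. -/
def KgOf (y ν : Pt → Fin 3 → ℝ) (p : Pt) : ℝ :=
  (IIOf y ν p).det / (IOf y p).det

/-- Mean curvature of an immersion `y` with unit normal `ν`. -/
def HmOf (y ν : Pt → Fin 3 → ℝ) (p : Pt) : ℝ :=
  -(1 / 2) * (weinOf y ν p).trace

/-- Smaller principal curvature `H − √(H² − K)` of an immersion `y`. -/
def k1Of (y ν : Pt → Fin 3 → ℝ) (p : Pt) : ℝ :=
  HmOf y ν p - Real.sqrt ((HmOf y ν p) ^ 2 - KgOf y ν p)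

/-- Larger principal curvature `H + √(H² − K)` of an immersion `y`. -/
def k2Of (y ν : Pt → Fin 3 → ℝ) (p : Pt) : ℝ :=
  HmOf y ν p + Real.sqrt ((HmOf y ν p) ^ 2 - KgOf y ν p)

/-- A frontal `x : U → ℝ³` equipped with a tangent moving base (tmb) `Ω` and the
induced smooth matrix-valued maps `Λ`, `μ` satisfying `Dx = Ω Λᵀ` and `Dn = Ω μᵀ` on `U`. -/
structure Frontal where
  /-- the domain -/
  U : Set Pt
  isOpen_U : IsOpen U
  /-- the frontal -/
  x : Pt → Fin 3 → ℝ
  /-- the tangent moving base -/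
  Ω : Pt → Matrix (Fin 3) (Fin 2) ℝ
  /-- `Λ` with `Dx = Ω Λᵀ` -/
  Λ : Pt → Matrix (Fin 2) (Fin 2) ℝ
  /-- `μ` with `Dn = Ω μᵀ` -/
  μ : Pt → Matrix (Fin 2) (Fin 2) ℝ
  smooth_x : ContDiffOn ℝ (⊤ : ℕ∞) x U
  smooth_Ω : ∀ i j, ContDiffOn ℝ (⊤ : ℕ∞) (fun p => Ω p i j) U
  smooth_Λ : ∀ i j, ContDiffOn ℝ (⊤ : ℕ∞) (fun p => Λ p i j) U
  smooth_μ : ∀ i j, ContDiffOn ℝ (⊤ : ℕ∞) (fun p => μ p i j) U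
  /-- the columns of `Ω` are linearly independent (nonzero cross product) -/
  indep : ∀ p ∈ U, crossProduct (fun i => Ω p i 0) (fun i => Ω p i 1) ≠ 0
  decomp_x : ∀ p ∈ U, jac x p = Ω p * (Λ p)ᵀ
  decomp_n : ∀ p ∈ U, jac (normalOf Ω) p = Ω p * (μ p)ᵀ

namespace Frontal

variable (F : Frontal)

/-- The unit normal induced by the tmb. -/
def n : Pt → Fin 3 → ℝ := normalOf F.Ω

/-- `λ_Ω := det Λ`. -/
def lam (p : Pt) : ℝ := (F.Λ p).det

/-- The Ω-relative curvature `K_Ω := det μ`. -/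
def KΩ (p : Pt) : ℝ := (F.μ p).det

/-- `α_Ω := μ · adj(Λ)`. -/
def αΩ (p : Pt) : Matrix (Fin 2) (Fin 2) ℝ := F.μ p * (F.Λ p).adjugate

/-- The Ω-relative mean curvature `H_Ω := −(1/2) tr α_Ω`. -/
def HΩ (p : Pt) : ℝ := -(1 / 2) * (F.αΩ p).trace

/-- The relative principal curvature `k_{1Ω} := H_Ω − √(H_Ω² − λ_Ω K_Ω)`. -/
def k1Ω (p : Pt) : ℝ := F.HΩ p - Real.sqrt ((F.HΩ p) ^ 2 - F.lam p * F.KΩ p)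

/-- The relative principal curvature `k_{2Ω} := H_Ω + √(H_Ω² − λ_Ω K_Ω)`. -/
def k2Ω (p : Pt) : ℝ := F.HΩ p + Real.sqrt ((F.HΩ p) ^ 2 - F.lam p * F.KΩ p)

/-- The singular set `Σ(x) = λ_Ω⁻¹(0)`. -/
def sing : Set Pt := {p ∈ F.U | F.lam p = 0}

/-- The regular set `U − Σ(x)`. -/
def reg : Set Pt := {p ∈ F.U | F.lam p ≠ 0}

/-- A frontal is proper if its singular set has empty interior. -/
def IsProper : Prop := interior F.sing = ∅

/-- `x` is a wavefront if `(x, n) : U → ℝ³ × S²` is an immersion. -/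
def IsWavefront : Prop :=
  ∀ p ∈ F.U, (Matrix.fromRows (jac F.x p) (jac F.n p)).rank = 2

/-- First fundamental form matrix `I = Dxᵀ Dx`. -/
def Imat (p : Pt) : Matrix (Fin 2) (Fin 2) ℝ := IOf F.x p

/-- Second fundamental form matrix `II = −Dxᵀ Dn`. -/
def IImat (p : Pt) : Matrix (Fin 2) (Fin 2) ℝ := IIOf F.x F.n p

/-- Weingarten matrix `α := −IIᵀ I⁻¹` (meaningful off the singular set). -/
def Wein (p : Pt) : Matrix (Fin 2) (Fin 2) ℝ := weinOf F.x F.n p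

/-- Coefficient `e` of the second fundamental form. -/
def e (p : Pt) : ℝ := F.IImat p 0 0

/-- Coefficient `f` of the second fundamental form. -/
def f (p : Pt) : ℝ := F.IImat p 0 1

/-- Coefficient `g` of the second fundamental form. -/
def g (p : Pt) : ℝ := F.IImat p 1 1

/-- Gaussian curvature (meaningful off the singular set). -/
def Kg (p : Pt) : ℝ := KgOf F.x F.n p

/-- Mean curvature (meaningful off the singular set). -/
def Hm (p : Pt) : ℝ := HmOf F.x F.n p

/-- Principal curvature `κ₋ := H − √(H² − K)`. -/
def κm (p : Pt) : ℝ := F.Hm p - Real.sqrt ((F.Hm p) ^ 2 - F.Kg p)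

/-- Principal curvature `κ₊ := H + √(H² − K)`. -/
def κp (p : Pt) : ℝ := F.Hm p + Real.sqrt ((F.Hm p) ^ 2 - F.Kg p)

/-- `k₁ := κ₋` where `λ_Ω > 0` and `k₁ := κ₊` where `λ_Ω < 0`. -/
def k1 (p : Pt) : ℝ := if 0 < F.lam p then F.κm p else F.κp p

/-- `k₂ := κ₊` where `λ_Ω > 0` and `k₂ := κ₋` where `λ_Ω < 0`. -/
def k2 (p : Pt) : ℝ := if 0 < F.lam p then F.κp p else F.κm p

/-- `x` is parallelly smoothable at `p` : for some `ε > 0` and some open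
neighborhood `V` of `p`, `rank D(x + l·n)(q) = 2` for all `(q,l) ∈ V × (0,ε)`
or for all `(q,l) ∈ V × (−ε,0)`. -/
def ParSmoothable (p : Pt) : Prop :=
  ∃ ε > (0 : ℝ), ∃ V : Set Pt, IsOpen V ∧ p ∈ V ∧ V ⊆ F.U ∧
    ((∀ q ∈ V, ∀ l ∈ Set.Ioo (0 : ℝ) ε,
        (jac (fun z => F.x z + l • F.n z) q).rank = 2) ∨
     (∀ q ∈ V, ∀ l ∈ Set.Ioo (-ε) (0 : ℝ),
        (jac (fun z => F.x z + l • F.n z) q).rank = 2))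

/-- `f` (defined off the singular set) has a `C^∞` extension to `V`. -/
def SmoothExtOn (f : Pt → ℝ) (V : Set Pt) : Prop :=
  ∃ g : Pt → ℝ, ContDiffOn ℝ (⊤ : ℕ∞) g V ∧ ∀ q ∈ V ∩ F.reg, g q = f q

/-- `f` has a `C^∞` extension to some open neighborhood of `p`. -/
def SmoothExtNear (f : Pt → ℝ) (p : Pt) : Prop :=
  ∃ V : Set Pt, IsOpen V ∧ p ∈ V ∧ V ⊆ F.U ∧ F.SmoothExtOn f V

/-- Membership in the principal ideal `𝔗_Ω(V)` generated by `λ_Ω` in `C^∞(V,ℝ)`. -/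
def memIdeal (f : Pt → ℝ) (V : Set Pt) : Prop :=
  ∃ φ : Pt → ℝ, ContDiffOn ℝ (⊤ : ℕ∞) φ V ∧ ∀ q ∈ V, f q = φ q * F.lam q

end Frontal

/-- `f` does not change sign on `V`. -/
def NoSignChange (f : Pt → ℝ) (V : Set Pt) : Prop :=
  (∀ q ∈ V, 0 ≤ f q) ∨ (∀ q ∈ V, f q ≤ 0)

theorem rank_eq_two_iff {ι : Type*} [Fintype ι] (A : Matrix ι (Fin 2) ℝ) :
    A.rank = 2 ↔ ∀ v, A *ᵥ v = 0 → v = 0 := by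
  have h := A.mulVecLin.finrank_range_add_finrank_ker
  have hker : (∀ v, A *ᵥ v = 0 → v = 0) ↔ Module.finrank ℝ (LinearMap.ker A.mulVecLin) = 0 := by
    rw [Submodule.finrank_eq_zero, LinearMap.ker_eq_bot']
    rfl
  rw [hker, Matrix.rank]
  simp only [Module.finrank_fintype_fun_eq_card, Fintype.card_fin] at h
  omega

theorem mulVec_eq_zero_of_crossProduct_ne_zero {W : Matrix (Fin 3) (Fin 2) ℝ}
    (hW : crossProduct (fun i => W i 0) (fun i => W i 1) ≠ 0) {u : Fin 2 → ℝ}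
    (hu : W *ᵥ u = 0) : u = 0 := by
  have h (i : Fin 3) : W i 0 * u 0 + W i 1 * u 1 = 0 := by
    simpa [Matrix.mulVec, dotProduct, Fin.sum_univ_two] using congrFun hu i
  have h0 := h 0
  have h1 := h 1
  have h2 := h 2
  by_contra hne
  apply hW
  have key : u 0 ≠ 0 ∨ u 1 ≠ 0 := by
    by_contra! hc
    exact hne (by ext i; fin_cases i <;> simp [hc.1, hc.2])
  rw [cross_apply]
  rcases key with k | k
  · ext i
    apply mul_left_cancel₀ k
    fin_cases i <;> simp <;> grind
  · ext i
    apply mul_left_cancel₀ k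
    fin_cases i <;> simp <;> grind

theorem rank_mul_transpose_eq_two_iff {W : Matrix (Fin 3) (Fin 2) ℝ}
    (hW : crossProduct (fun i => W i 0) (fun i => W i 1) ≠ 0) (M : Matrix (Fin 2) (Fin 2) ℝ) :
    (W * Mᵀ).rank = 2 ↔ M.det ≠ 0 := by
  rw [rank_eq_two_iff, ← Matrix.det_transpose, ne_eq, ← Matrix.exists_mulVec_eq_zero_iff]
  push Not
  refine forall_congr' fun v => ?_
  rw [← Matrix.mulVec_mulVec]
  constructor
  · intro h hv h0
    exact hv (h (by rw [h0, Matrix.mulVec_zero]))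
  · intro h h0
    by_contra hv
    exact h hv (mulVec_eq_zero_of_crossProduct_ne_zero hW h0)

/-- The linear coefficient in `l` of `det (A + l • B)`. -/
def mixedDet (A B : Matrix (Fin 2) (Fin 2) ℝ) : ℝ :=
  A 0 0 * B 1 1 + B 0 0 * A 1 1 - A 0 1 * B 1 0 - B 0 1 * A 1 0

theorem det_add_smul_fin_two (A B : Matrix (Fin 2) (Fin 2) ℝ) (l : ℝ) :
    (A + l • B).det = A.det + l * (mixedDet A B + l * B.det) := by
  simp [Matrix.det_fin_two, mixedDet]
  ring

theorem mixedDet_ne_zero {W : Matrix (Fin 3) (Fin 2) ℝ} {A B : Matrix (Fin 2) (Fin 2) ℝ}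
    (hW : crossProduct (fun i => W i 0) (fun i => W i 1) ≠ 0)
    (hsymm : ((W * Aᵀ)ᵀ * (W * Bᵀ)).IsSymm)
    (hrank : (Matrix.fromRows (W * Aᵀ) (W * Bᵀ)).rank = 2)
    (hdet : A.det = 0) (hA : A ≠ 0) : mixedDet A B ≠ 0 := by
  intro ht
  obtain ⟨v, hv, hAv⟩ := Matrix.exists_mulVec_eq_zero_iff.2 ((Matrix.det_transpose A).trans hdet)
  set w := Bᵀ *ᵥ v with hw
  have hw0 : w ≠ 0 := by
    intro h0
    apply hv
    apply (rank_eq_two_iff _).1 hrank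
    rw [Matrix.fromRows_mulVec, ← Matrix.mulVec_mulVec, ← Matrix.mulVec_mulVec, hAv, ← hw, h0]
    ext i
    cases i <;> simp
  -- symmetry of the second fundamental form: `Dx` is orthogonal to `Dn v`
  have horth : A *ᵥ (Wᵀ *ᵥ (W *ᵥ w)) = 0 := by
    have h1 : ((W * Aᵀ)ᵀ * (W * Bᵀ)) *ᵥ v = A *ᵥ (Wᵀ *ᵥ (W *ᵥ w)) := by
      simp only [hw, Matrix.transpose_mul, Matrix.transpose_transpose, Matrix.mulVec_mulVec,
        Matrix.mul_assoc]
    have h2 : ((W * Aᵀ)ᵀ * (W * Bᵀ))ᵀ *ᵥ v = 0 := by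
      rw [Matrix.transpose_mul, Matrix.transpose_transpose, ← Matrix.mulVec_mulVec,
        ← Matrix.mulVec_mulVec, hAv, Matrix.mulVec_zero, Matrix.mulVec_zero]
    rw [← h1, ← h2, hsymm.eq]
  set g := Wᵀ *ᵥ (W *ᵥ w) with hg
  have hpos : w 0 * g 0 + w 1 * g 1 ≠ 0 := by
    intro h0
    apply hw0
    apply mulVec_eq_zero_of_crossProduct_ne_zero hW
    rw [← dotProduct_self_eq_zero, Matrix.dotProduct_mulVec, ← Matrix.mulVec_transpose,
      dotProduct_comm, ← hg]
    simpa [dotProduct, Fin.sum_univ_two] using h0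
  have a0 : A 0 0 * v 0 + A 1 0 * v 1 = 0 := by
    simpa [Matrix.mulVec, dotProduct, Fin.sum_univ_two] using congrFun hAv 0
  have a1 : A 0 1 * v 0 + A 1 1 * v 1 = 0 := by
    simpa [Matrix.mulVec, dotProduct, Fin.sum_univ_two] using congrFun hAv 1
  have o0 : A 0 0 * g 0 + A 0 1 * g 1 = 0 := by
    simpa [Matrix.mulVec, dotProduct, Fin.sum_univ_two] using congrFun horth 0
  have o1 : A 1 0 * g 0 + A 1 1 * g 1 = 0 := by
    simpa [Matrix.mulVec, dotProduct, Fin.sum_univ_two] using congrFun horth 1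
  have w0 : w 0 = B 0 0 * v 0 + B 1 0 * v 1 := by
    simp [hw]
  have w1 : w 1 = B 0 1 * v 0 + B 1 1 * v 1 := by
    simp [hw]
  clear_value w g
  unfold mixedDet at ht
  -- the rows of `A` are parallel to `w`
  have p0 : (A 0 0 * w 1 - A 0 1 * w 0) = 0 := by
    linear_combination A 0 0 * w1 - A 0 1 * w0 + B 0 1 * a0 - B 0 0 * a1 + v 1 * ht
  have p1 : (A 1 0 * w 1 - A 1 1 * w 0) = 0 := by
    linear_combination A 1 0 * w1 - A 1 1 * w0 + B 1 1 * a0 - B 1 0 * a1 - v 0 * ht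
  apply hA
  have z00 : A 0 0 = 0 := by
    apply mul_left_cancel₀ hpos
    linear_combination w 0 * o0 + g 1 * p0
  have z01 : A 0 1 = 0 := by
    apply mul_left_cancel₀ hpos
    linear_combination w 1 * o0 - g 0 * p0
  have z10 : A 1 0 = 0 := by
    apply mul_left_cancel₀ hpos
    linear_combination w 0 * o1 + g 1 * p1
  have z11 : A 1 1 = 0 := by
    apply mul_left_cancel₀ hpos
    linear_combination w 1 * o1 - g 0 * p1
  ext i j
  fin_cases i <;> fin_cases j <;> simp [z00, z01, z10, z11]

namespace Frontal

variable (F : Frontal)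

theorem contDiffOn_n : ContDiffOn ℝ (⊤ : ℕ∞) F.n F.U := by
  have hc : ContDiffOn ℝ (⊤ : ℕ∞)
      (fun q => crossProduct (fun i => F.Ω q i 0) (fun i => F.Ω q i 1)) F.U := by
    rw [contDiffOn_pi]
    have h := F.smooth_Ω
    intro i
    fin_cases i <;> simp only [cross_apply] <;> simp <;>
      exact ((h _ _).mul (h _ _)).sub ((h _ _).mul (h _ _))
  have hd : ContDiffOn ℝ (⊤ : ℕ∞) (fun q =>
      crossProduct (fun i => F.Ω q i 0) (fun i => F.Ω q i 1) ⬝ᵥ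
        crossProduct (fun i => F.Ω q i 0) (fun i => F.Ω q i 1)) F.U := by
    simp only [dotProduct]
    exact ContDiffOn.sum fun i _ => (contDiffOn_pi.1 hc i).mul (contDiffOn_pi.1 hc i)
  have hne : ∀ q ∈ F.U, crossProduct (fun i => F.Ω q i 0) (fun i => F.Ω q i 1) ⬝ᵥ
      crossProduct (fun i => F.Ω q i 0) (fun i => F.Ω q i 1) ≠ 0 := fun q hq h =>
    F.indep q hq (dotProduct_self_eq_zero.1 h)
  refine ContDiffOn.smul (ContDiffOn.inv (hd.sqrt hne) fun q hq h => hne q hq ?_) hc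
  refine (Real.sqrt_eq_zero ?_).1 h
  simp only [dotProduct]
  exact Finset.sum_nonneg fun i _ => mul_self_nonneg _

variable {F} {q : Pt}

theorem differentiableAt_x (hq : q ∈ F.U) : DifferentiableAt ℝ F.x q :=
  (F.smooth_x.contDiffAt (F.isOpen_U.mem_nhds hq)).differentiableAt (by simp)

theorem differentiableAt_n (hq : q ∈ F.U) : DifferentiableAt ℝ F.n q :=
  (F.contDiffOn_n.contDiffAt (F.isOpen_U.mem_nhds hq)).differentiableAt (by simp)

theorem jac_parallel (hq : q ∈ F.U) (l : ℝ) :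
    jac (fun z => F.x z + l • F.n z) q = F.Ω q * (F.Λ q + l • F.μ q)ᵀ := by
  have h : jac (fun z => F.x z + l • F.n z) q = jac F.x q + l • jac F.n q := by
    ext i j
    simp only [jac, Matrix.of_apply, Matrix.add_apply, Matrix.smul_apply]
    rw [((differentiableAt_x hq).hasFDerivAt.fun_add
      ((differentiableAt_n hq).hasFDerivAt.fun_const_smul l)).fderiv]
    rfl
  have hn : jac F.n q = F.Ω q * (F.μ q)ᵀ := F.decomp_n q hq
  rw [h, F.decomp_x q hq, hn, Matrix.transpose_add, Matrix.transpose_smul, Matrix.mul_add,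
    Matrix.mul_smul]

theorem rank_jac_parallel (hq : q ∈ F.U) (l : ℝ) :
    (jac (fun z => F.x z + l • F.n z) q).rank = 2 ↔ (F.Λ q + l • F.μ q).det ≠ 0 := by
  rw [jac_parallel hq, rank_mul_transpose_eq_two_iff (F.indep q hq)]

theorem n_dotProduct_fderiv (hq : q ∈ F.U) (j : Fin 2) :
    F.n q ⬝ᵥ fderiv ℝ F.x q (Pi.single j 1) = 0 := by
  have h : fderiv ℝ F.x q (Pi.single j 1) = F.Ω q *ᵥ (F.Λ q j) := by
    ext i
    have := congrFun (congrFun (F.decomp_x q hq) i) j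
    simpa [jac, Matrix.mul_apply, Matrix.mulVec, dotProduct] using this
  have h' : F.Ω q *ᵥ (F.Λ q j) =
      F.Λ q j 0 • (fun i => F.Ω q i 0) + F.Λ q j 1 • (fun i => F.Ω q i 1) := by
    ext i
    simp [Matrix.mulVec, dotProduct, Fin.sum_univ_two, mul_comm]
  rw [h, h', n, normalOf, smul_dotProduct, dotProduct_add, dotProduct_smul, dotProduct_smul,
    dotProduct_comm, dot_self_cross, dotProduct_comm, dot_cross_self]
  simp

theorem isSymm_jac_transpose_mul_jac (hq : q ∈ F.U) :
    ((jac F.x q)ᵀ * jac F.n q).IsSymm := by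
  have hx := F.smooth_x.contDiffAt (F.isOpen_U.mem_nhds hq)
  have hdx : DifferentiableAt ℝ (fderiv ℝ F.x) q :=
    (hx.fderiv_right (m := 1) (by norm_cast)).differentiableAt (by simp)
  have hsym : IsSymmSndFDerivAt ℝ F.x q := hx.isSymmSndFDerivAt (by
    rw [minSmoothness_of_isRCLikeNormedField]
    exact WithTop.coe_le_coe.2 (le_top : (2 : ℕ∞) ≤ ⊤))
  have key (i j : Fin 2) : ((jac F.x q)ᵀ * jac F.n q) j i =
      -(F.n q ⬝ᵥ fderiv ℝ (fderiv ℝ F.x) q (Pi.single i 1) (Pi.single j 1)) := by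
    have hzero : (fun z => F.n z ⬝ᵥ fderiv ℝ F.x z (Pi.single j 1)) =ᶠ[𝓝 q] fun _ => 0 := by
      filter_upwards [F.isOpen_U.mem_nhds hq] with z hz
      exact n_dotProduct_fderiv hz j
    have hn (k : Fin 3) : HasFDerivAt (fun z => F.n z k)
        ((ContinuousLinearMap.proj k).comp (fderiv ℝ F.n q)) q :=
      hasFDerivAt_pi'.1 (differentiableAt_n hq).hasFDerivAt k
    have hxj (k : Fin 3) : HasFDerivAt (fun z => fderiv ℝ F.x z (Pi.single j 1) k)
        ((ContinuousLinearMap.proj k).comp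
          ((fderiv ℝ (fderiv ℝ F.x) q).flip (Pi.single j 1))) q :=
      hasFDerivAt_pi'.1 (by
        simpa using hdx.hasFDerivAt.clm_apply
          (hasFDerivAt_const (Pi.single j 1 : Pt) q)) k
    have hsum := HasFDerivAt.fun_sum (u := Finset.univ) fun k _ => (hn k).mul (hxj k)
    have h0 := hsum.unique ((hasFDerivAt_const (0 : ℝ) q).congr_of_eventuallyEq hzero)
    have h1 := congrArg (fun L => L (Pi.single i 1)) h0
    simp [Finset.sum_add_distrib] at h1
    simp only [Matrix.mul_apply, Matrix.transpose_apply, jac, Matrix.of_apply, dotProduct]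
    linarith
  ext i j
  rw [Matrix.transpose_apply, key, key, hsym.eq]

theorem mixedDet_ne_zero (hW : F.IsWavefront) (hq : q ∈ F.sing) (hr : (jac F.x q).rank = 1) :
    mixedDet (F.Λ q) (F.μ q) ≠ 0 := by
  have hn : jac F.n q = F.Ω q * (F.μ q)ᵀ := F.decomp_n q hq.1
  have hsymm := isSymm_jac_transpose_mul_jac hq.1
  have hrank := hW q hq.1
  rw [F.decomp_x q hq.1, hn] at hsymm hrank
  refine _root_.mixedDet_ne_zero (F.indep q hq.1) hsymm hrank hq.2 fun h0 => ?_
  rw [F.decomp_x q hq.1, h0] at hr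
  simp at hr

theorem continuousOn_lam : ContinuousOn F.lam F.U := by
  have h (i j) := (F.smooth_Λ i j).continuousOn
  have he : F.lam = fun z => F.Λ z 0 0 * F.Λ z 1 1 - F.Λ z 0 1 * F.Λ z 1 0 :=
    funext fun z => Matrix.det_fin_two _
  rw [he]
  exact ((h _ _).mul (h _ _)).sub ((h _ _).mul (h _ _))

theorem continuousOn_KΩ : ContinuousOn F.KΩ F.U := by
  have h (i j) := (F.smooth_μ i j).continuousOn
  have he : F.KΩ = fun z => F.μ z 0 0 * F.μ z 1 1 - F.μ z 0 1 * F.μ z 1 0 :=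
    funext fun z => Matrix.det_fin_two _
  rw [he]
  exact ((h _ _).mul (h _ _)).sub ((h _ _).mul (h _ _))

theorem continuousOn_mixedDet : ContinuousOn (fun z => mixedDet (F.Λ z) (F.μ z)) F.U := by
  have h (i j) := (F.smooth_Λ i j).continuousOn
  have h' (i j) := (F.smooth_μ i j).continuousOn
  exact ((((h _ _).mul (h' _ _)).add ((h' _ _).mul (h _ _))).sub ((h _ _).mul (h' _ _))).sub
    ((h' _ _).mul (h _ _))

theorem noSignChange_of_det_ne_zero {B : Set Pt} (hBU : B ⊆ F.U) (hB : IsPreconnected B)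
    {I : Set ℝ} (hI : IsPreconnected I) [(𝓝[I] (0 : ℝ)).NeBot]
    (h : ∀ z ∈ B, ∀ l ∈ I, (F.Λ z + l • F.μ z).det ≠ 0) : NoSignChange F.lam B := by
  set G : Pt × ℝ → ℝ := fun z =>
    F.lam z.1 + z.2 * (mixedDet (F.Λ z.1) (F.μ z.1) + z.2 * F.KΩ z.1) with hG
  have hGdet (z : Pt) (l : ℝ) : G (z, l) = (F.Λ z + l • F.μ z).det :=
    (det_add_smul_fin_two _ _ _).symm
  have hfst : Set.MapsTo Prod.fst (B ×ˢ I) F.U := fun z hz => hBU hz.1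
  have hcont : ContinuousOn G (B ×ˢ I) :=
    (continuousOn_lam.comp continuousOn_fst hfst).add
      (continuousOn_snd.mul ((continuousOn_mixedDet.comp continuousOn_fst hfst).add
        (continuousOn_snd.mul (continuousOn_KΩ.comp continuousOn_fst hfst))))
  have hconn := (hB.prod hI).image G hcont
  have hne : (0 : ℝ) ∉ G '' (B ×ˢ I) := by
    rintro ⟨⟨z, l⟩, hz, h0⟩
    exact h z hz.1 l hz.2 ((hGdet z l).symm.trans h0)
  have hlim (z : Pt) : Tendsto (fun l => G (z, l)) (𝓝[I] 0) (𝓝 (F.lam z)) := by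
    have hc : Continuous fun l => G (z, l) := by
      simp only [hG]
      fun_prop
    simpa [hG] using (hc.tendsto 0).mono_left (nhdsWithin_le_nhds (s := I))
  by_cases hpos : ∀ y ∈ G '' (B ×ˢ I), 0 ≤ y
  · refine Or.inl fun z hz => ge_of_tendsto (hlim z) ?_
    filter_upwards [self_mem_nhdsWithin] with l hl
    exact hpos _ ⟨(z, l), ⟨hz, hl⟩, rfl⟩
  · push Not at hpos
    obtain ⟨y, hy, hy0⟩ := hpos
    refine Or.inr fun z hz => le_of_tendsto (hlim z) ?_
    filter_upwards [self_mem_nhdsWithin] with l hl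
    by_contra! hlt
    exact hne (hconn.ordConnected.out hy ⟨(z, l), ⟨hz, hl⟩, rfl⟩ ⟨hy0.le, hlt.le⟩)

theorem exists_noSignChange_of_parSmoothable (h : F.ParSmoothable q) :
    ∃ V : Set Pt, IsOpen V ∧ q ∈ V ∧ V ⊆ F.U ∧ NoSignChange F.lam V := by
  obtain ⟨ε, hε, V, hVo, hqV, hVU, h⟩ := h
  obtain ⟨r, hr, hball⟩ := Metric.isOpen_iff.1 hVo q hqV
  refine ⟨Metric.ball q r, Metric.isOpen_ball, Metric.mem_ball_self hr, hball.trans hVU, ?_⟩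
  have hconn : IsPreconnected (Metric.ball q r) := (convex_ball q r).isPreconnected
  rcases h with h | h
  · have : (𝓝[Set.Ioo 0 ε] (0 : ℝ)).NeBot := left_nhdsWithin_Ioo_neBot hε
    exact noSignChange_of_det_ne_zero (hball.trans hVU) hconn isPreconnected_Ioo
      fun z hz l hl => (rank_jac_parallel (hVU (hball hz)) l).1 (h z (hball hz) l hl)
  · have : (𝓝[Set.Ioo (-ε) 0] (0 : ℝ)).NeBot := right_nhdsWithin_Ioo_neBot (by linarith)
    exact noSignChange_of_det_ne_zero (hball.trans hVU) hconn isPreconnected_Ioo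
      fun z hz l hl => (rank_jac_parallel (hVU (hball hz)) l).1 (h z (hball hz) l hl)

theorem parSmoothable_of_noSignChange (hq : mixedDet (F.Λ q) (F.μ q) ≠ 0) {V : Set Pt}
    (hVo : IsOpen V) (hqV : q ∈ V) (hVU : V ⊆ F.U) (hV : NoSignChange F.lam V) :
    F.ParSmoothable q := by
  have hU := F.isOpen_U.mem_nhds (hVU hqV)
  set H : Pt × ℝ → ℝ := fun z => mixedDet (F.Λ z.1) (F.μ z.1) + z.2 * F.KΩ z.1 with hH
  have hcont : ContinuousAt H (q, 0) :=
    (ContinuousAt.comp (f := Prod.fst) (continuousOn_mixedDet.continuousAt hU)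
      continuousAt_fst).add (continuousAt_snd.mul
        (ContinuousAt.comp (f := Prod.fst) (continuousOn_KΩ.continuousAt hU) continuousAt_fst))
  have hH0 : H (q, 0) = mixedDet (F.Λ q) (F.μ q) := by simp [hH]
  have hdet (z : Pt) (l : ℝ) : (F.Λ z + l • F.μ z).det = F.lam z + l * H (z, l) :=
    det_add_smul_fin_two _ _ _
  have hnhds {s : Set ℝ} (hs : s ∈ 𝓝 (H (q, 0))) : ∃ ε > (0 : ℝ), ∃ W : Set Pt, IsOpen W ∧
      q ∈ W ∧ W ⊆ V ∧ ∀ z ∈ W, ∀ l ∈ Set.Ioo (-ε) ε, H (z, l) ∈ s := by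
    obtain ⟨ε, hε, hball⟩ := Metric.mem_nhds_iff.1 (hcont hs)
    refine ⟨ε, hε, V ∩ Metric.ball q ε, hVo.inter Metric.isOpen_ball,
      ⟨hqV, Metric.mem_ball_self hε⟩, Set.inter_subset_left, fun z hz l hl => hball ?_⟩
    rw [← ball_prod_same]
    exact ⟨hz.2, by simpa [Real.ball_eq_Ioo] using hl⟩
  rcases lt_or_gt_of_ne hq with ht | ht
  · obtain ⟨ε, hε, W, hWo, hqW, hWV, hWH⟩ := hnhds (Iio_mem_nhds (hH0.trans_lt ht))
    refine ⟨ε, hε, W, hWo, hqW, hWV.trans hVU, ?_⟩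
    rcases hV with hV | hV
    · refine Or.inr fun z hz l hl => ?_
      rw [rank_jac_parallel (hVU (hWV hz)), hdet]
      exact (add_pos_of_nonneg_of_pos (hV z (hWV hz))
        (mul_pos_of_neg_of_neg hl.2 (hWH z hz l ⟨hl.1, hl.2.trans hε⟩))).ne'
    · refine Or.inl fun z hz l hl => ?_
      rw [rank_jac_parallel (hVU (hWV hz)), hdet]
      exact (add_neg_of_nonpos_of_neg (hV z (hWV hz))
        (mul_neg_of_pos_of_neg hl.1 (hWH z hz l ⟨by linarith [hl.1], hl.2⟩))).ne
  · obtain ⟨ε, hε, W, hWo, hqW, hWV, hWH⟩ := hnhds (Ioi_mem_nhds (ht.trans_eq hH0.symm))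
    refine ⟨ε, hε, W, hWo, hqW, hWV.trans hVU, ?_⟩
    rcases hV with hV | hV
    · refine Or.inl fun z hz l hl => ?_
      rw [rank_jac_parallel (hVU (hWV hz)), hdet]
      exact (add_pos_of_nonneg_of_pos (hV z (hWV hz))
        (mul_pos hl.1 (hWH z hz l ⟨by linarith [hl.1], hl.2⟩))).ne'
    · refine Or.inr fun z hz l hl => ?_
      rw [rank_jac_parallel (hVU (hWV hz)), hdet]
      exact (add_neg_of_nonpos_of_neg (hV z (hWV hz))
        (mul_neg_of_neg_of_pos hl.2 (hWH z hz l ⟨hl.1, hl.2.trans hε⟩))).ne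

end Frontal

/-- at a rank-1 singularity of a wavefront, `x` is parallelly
smoothable at `p` iff `λ_Ω` does not change sign on some open neighborhood of `p`. -/
theorem stmt14 (F : Frontal) (hW : F.IsWavefront)
    (p : Pt) (hp : p ∈ F.sing) (hr : (jac F.x p).rank = 1) :
    F.ParSmoothable p ↔
      ∃ V : Set Pt, IsOpen V ∧ p ∈ V ∧ V ⊆ F.U ∧ NoSignChange F.lam V := by
  refine ⟨Frontal.exists_noSignChange_of_parSmoothable, ?_⟩
  rintro ⟨V, hVo, hpV, hVU, hV⟩
  exact Frontal.parSmoothable_of_noSignChange (Frontal.mixedDet_ne_zero hW hp hr) hVo hpV hVU hV
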